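/- Let L be a finite field extension of ℚ₂ of odd degree, and let 𝔒 be its ring of integers; assume 2 is a prime element of 𝔒. If x, y, z ∈ L satisfy x² + y² + z² ∈ 𝔒, then x, y, z ∈ 𝔒. -/

import Mathlib

theorem FiniteField.eq_zero_of_sq_add_mul_add_sq_eq_zero {K : Type*} [Field K] [Finite K]
    (h2 : (2 : K) = 0) {n : ℕ} (hn : Odd n) (hcard : Nat.card K = 2 ^ n) {x y : K}
    (h : x ^ 2 + x * y + y ^ 2 = 0) : x = 0 := by
  by_contra hx
  have hy : y ≠ 0 := by
    rintro rfl
    exact hx (by simpa using h)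
  have hcube : x ^ 3 = y ^ 3 := by linear_combination (x - y) * h
  obtain ⟨m, hm⟩ : ∃ m, 2 ^ n = 3 * m + 2 := by
    obtain ⟨k, rfl⟩ := hn
    refine ⟨2 ^ (2 * k + 1) / 3, ?_⟩
    have : 2 ^ (2 * k + 1) % 3 = 2 := by
      rw [pow_succ, pow_mul, Nat.mul_mod, Nat.pow_mod]
      simp
    rw [← Nat.div_add_mod (2 ^ (2 * k + 1)) 3, this]
    omega
  have key (w : K) (hw : w ≠ 0) : (w ^ 3) ^ m * w = 1 := by
    have := Fintype.ofFinite K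
    have hw' := FiniteField.pow_card w
    rw [← Nat.card_eq_fintype_card, hcard, hm, pow_add, pow_mul] at hw'
    apply mul_right_cancel₀ hw
    linear_combination hw'
  have hxy : x = y := by
    have hc : (x ^ 3) ^ m ≠ 0 := pow_ne_zero _ (pow_ne_zero _ hx)
    exact mul_left_cancel₀ hc ((key x hx).trans (by rw [hcube, key y hy]))
  subst hxy
  exact pow_ne_zero 2 hx (by linear_combination h - x ^ 2 * h2)

theorem two_dvd_of_four_dvd_sum_three_squares {R : Type*} [CommRing R] [IsDomain R] (h2 : Prime (2 : R))
    (haniso : ∀ a b : R, 2 ∣ a ^ 2 + a * b + b ^ 2 → 2 ∣ a) {x y z : R}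
    (h : 4 ∣ x ^ 2 + y ^ 2 + z ^ 2) : 2 ∣ x ∧ 2 ∣ y ∧ 2 ∣ z := by
  obtain ⟨c, hc⟩ := h
  obtain ⟨t, ht⟩ : 2 ∣ x + y + z := by
    refine h2.dvd_of_dvd_pow (n := 2) ⟨2 * c + x * y + y * z + z * x, ?_⟩
    linear_combination hc
  have hz : z = 2 * t - x - y := by linear_combination ht
  subst hz
  have hd : 2 ∣ x ^ 2 + x * y + y ^ 2 := by
    refine ⟨c - t ^ 2 + t * (x + y), mul_left_cancel₀ h2.ne_zero ?_⟩
    linear_combination hc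
  have hx := haniso x y hd
  have hy := haniso y x (by convert hd using 1; ring)
  exact ⟨hx, hy, dvd_sub (dvd_sub (dvd_mul_right _ _) hx) hy⟩

theorem IsLocalRing.natCard_quotient_map_maximalIdeal (R S : Type*) [CommRing R] [IsLocalRing R]
    [CommRing S] [Algebra R S] [Module.Free R S] [Module.Finite R S] :
    Nat.card (S ⧸ (maximalIdeal R).map (algebraMap R S)) =
      Nat.card (R ⧸ maximalIdeal R) ^ Module.finrank R S := by
  rw [Nat.card_congr (basisQuotient (Module.Free.chooseBasis R S)).equivFun.toEquiv, Nat.card_fun,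
    Nat.card_eq_fintype_card (α := Module.Free.ChooseBasisIndex R S),
    Module.finrank_eq_card_chooseBasisIndex]

section Padic

variable (L : Type*) [Field L] [Algebra ℚ_[2] L] [FiniteDimensional ℚ_[2] L]
  [Algebra ℤ_[2] L] [IsScalarTower ℤ_[2] ℚ_[2] L]

theorem natCard_integralClosure_padicInt_quotient_two :
    Nat.card (integralClosure ℤ_[2] L ⧸ Ideal.span {(2 : integralClosure ℤ_[2] L)}) =
      2 ^ Module.finrank ℚ_[2] L := by
  have : Module.IsTorsionFree ℤ_[2] L := .trans_faithfulSMul ℤ_[2] ℚ_[2] L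
  have : Module.Finite ℤ_[2] (integralClosure ℤ_[2] L) :=
    IsIntegralClosure.finite ℤ_[2] ℚ_[2] L _
  have : Module.Free ℤ_[2] (integralClosure ℤ_[2] L) :=
    IsIntegralClosure.module_free ℤ_[2] ℚ_[2] L _
  have hmap : (IsLocalRing.maximalIdeal ℤ_[2]).map
      (algebraMap ℤ_[2] (integralClosure ℤ_[2] L)) = Ideal.span {2} := by
    rw [PadicInt.maximalIdeal_eq_span_p, Ideal.map_span, Set.image_singleton, map_natCast,
      Nat.cast_ofNat]
  have hres : Nat.card (ℤ_[2] ⧸ IsLocalRing.maximalIdeal ℤ_[2]) = 2 :=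
    (Nat.card_congr (PadicInt.residueField (p := 2)).toEquiv).trans (Nat.card_zmod 2)
  rw [← hmap, IsLocalRing.natCard_quotient_map_maximalIdeal, hres,
    IsIntegralClosure.rank ℤ_[2] ℚ_[2] L (integralClosure ℤ_[2] L)]

variable {L}

theorem two_dvd_of_two_dvd_sq_add_mul_add_sq (hodd : Odd (Module.finrank ℚ_[2] L))
    (h2 : Prime (2 : integralClosure ℤ_[2] L)) (a b : integralClosure ℤ_[2] L)
    (h : 2 ∣ a ^ 2 + a * b + b ^ 2) : 2 ∣ a := by
  have hcard := natCard_integralClosure_padicInt_quotient_two L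
  have := (Ideal.span_singleton_prime h2.ne_zero).mpr h2
  have : Finite (integralClosure ℤ_[2] L ⧸ Ideal.span {(2 : integralClosure ℤ_[2] L)}) :=
    Nat.finite_of_card_ne_zero (by rw [hcard]; positivity)
  let : Field (integralClosure ℤ_[2] L ⧸ Ideal.span {(2 : integralClosure ℤ_[2] L)}) :=
    (Finite.isField_of_domain _).toField
  rw [← Ideal.mem_span_singleton, ← Ideal.Quotient.eq_zero_iff_mem] at h ⊢
  have htwo : (2 : integralClosure ℤ_[2] L ⧸ Ideal.span {(2 : integralClosure ℤ_[2] L)}) = 0 :=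
    Ideal.Quotient.eq_zero_iff_mem.mpr (Ideal.mem_span_singleton_self 2)
  exact FiniteField.eq_zero_of_sq_add_mul_add_sq_eq_zero htwo hodd hcard
    (y := Ideal.Quotient.mk _ b) (by simpa using h)

theorem exists_two_pow_mul_mem_integralClosure (x : L) :
    ∃ n : ℕ, 2 ^ n * x ∈ integralClosure ℤ_[2] L := by
  have : Algebra.IsAlgebraic ℤ_[2] L :=
    (IsFractionRing.comap_isAlgebraic_iff (K := ℚ_[2])).mpr inferInstance
  obtain ⟨m, hm, hint⟩ := (Algebra.IsAlgebraic.isAlgebraic (R := ℤ_[2]) x).exists_integral_multiple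
  refine ⟨m.valuation, ?_⟩
  have hspec := PadicInt.unitCoeff_spec hm
  set u := PadicInt.unitCoeff hm
  have h := (integralClosure ℤ_[2] L).smul_mem hint (↑u⁻¹ : ℤ_[2])
  have heq : (↑u⁻¹ : ℤ_[2]) * m = 2 ^ m.valuation := by
    conv_lhs => rw [hspec]
    simp
  rwa [smul_smul, heq, Algebra.smul_def, map_pow, map_ofNat] at h

theorem mem_integralClosure_of_two_pow_mul_mem
    (hodd : Odd (Module.finrank ℚ_[2] L)) (h2 : Prime (2 : integralClosure ℤ_[2] L))
    {x y z : L} (h : x ^ 2 + y ^ 2 + z ^ 2 ∈ integralClosure ℤ_[2] L) (n : ℕ)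
    (hx : 2 ^ n * x ∈ integralClosure ℤ_[2] L) (hy : 2 ^ n * y ∈ integralClosure ℤ_[2] L)
    (hz : 2 ^ n * z ∈ integralClosure ℤ_[2] L) :
    x ∈ integralClosure ℤ_[2] L ∧ y ∈ integralClosure ℤ_[2] L ∧
      z ∈ integralClosure ℤ_[2] L := by
  induction n with
  | zero => simpa using And.intro hx (And.intro hy hz)
  | succ n ih =>
    have h2L : (2 : L) ≠ 0 := fun h0 ↦ h2.ne_zero (Subtype.ext h0)
    have hdiv : (4 : integralClosure ℤ_[2] L) ∣ ⟨_, hx⟩ ^ 2 + ⟨_, hy⟩ ^ 2 + ⟨_, hz⟩ ^ 2 := by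
      refine ⟨4 ^ n * ⟨_, h⟩, Subtype.ext ?_⟩
      change (2 ^ (n + 1) * x) ^ 2 + (2 ^ (n + 1) * y) ^ 2 + (2 ^ (n + 1) * z) ^ 2 =
        4 * (4 ^ n * (x ^ 2 + y ^ 2 + z ^ 2))
      rw [show (4 : L) ^ n = (2 ^ n) ^ 2 by rw [← pow_mul, mul_comm, pow_mul]; norm_num]
      ring
    have hhalf {w : L} (hw : 2 ^ (n + 1) * w ∈ integralClosure ℤ_[2] L)
        (hd : (2 : integralClosure ℤ_[2] L) ∣ ⟨_, hw⟩) :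
        2 ^ n * w ∈ integralClosure ℤ_[2] L := by
      obtain ⟨c, hc⟩ := hd
      have hc' : 2 ^ (n + 1) * w = 2 * (c : L) := congrArg Subtype.val hc
      have : 2 ^ n * w = c := mul_left_cancel₀ h2L (by rw [← hc']; ring)
      exact this ▸ c.2
    obtain ⟨dx, dy, dz⟩ := two_dvd_of_four_dvd_sum_three_squares h2
      (two_dvd_of_two_dvd_sq_add_mul_add_sq hodd h2) hdiv
    exact ih (hhalf hx dx) (hhalf hy dy) (hhalf hz dz)

end Padic


/- Setting: `L` is a finite field extension of `ℚ₂` of odd degree, `𝔒` is its ring of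
integers (the integral closure of `ℤ₂` in `L`), and `2` is a prime element of `𝔒`
(equivalently, `L/ℚ₂` is unramified). -/
/-- Let `L` be a finite extension of `ℚ₂` of odd degree with ring of
integers `𝔒 = integralClosure ℤ₂ L`, and assume `2` is a prime element of `𝔒`. If
`x, y, z ∈ L` satisfy `x² + y² + z² ∈ 𝔒`, then `x, y, z ∈ 𝔒`. -/
theorem integral_sum_of_three_squares_has_integral_entries_in_odd_unramified_dyadic
    (L : Type*) [Field L] [Algebra ℚ_[2] L] [FiniteDimensional ℚ_[2] L]
    [Algebra ℤ_[2] L] [IsScalarTower ℤ_[2] ℚ_[2] L]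
    (hodd : Odd (Module.finrank ℚ_[2] L))
    (h2 : Prime (2 : integralClosure ℤ_[2] L))
    (x y z : L) (h : x ^ 2 + y ^ 2 + z ^ 2 ∈ integralClosure ℤ_[2] L) :
    x ∈ integralClosure ℤ_[2] L ∧ y ∈ integralClosure ℤ_[2] L ∧ z ∈ integralClosure ℤ_[2] L := by
  obtain ⟨i, hi⟩ := exists_two_pow_mul_mem_integralClosure x
  obtain ⟨j, hj⟩ := exists_two_pow_mul_mem_integralClosure y
  obtain ⟨k, hk⟩ := exists_two_pow_mul_mem_integralClosure z
  have htwo : (2 : L) ∈ integralClosure ℤ_[2] L := (2 : integralClosure ℤ_[2] L).2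
  refine mem_integralClosure_of_two_pow_mul_mem hodd h2 h (i + j + k) ?_ ?_ ?_
  · convert mul_mem (pow_mem htwo (j + k)) hi using 1
    ring
  · convert mul_mem (pow_mem htwo (i + k)) hj using 1
    ring
  · convert mul_mem (pow_mem htwo (i + j)) hk using 1
    ring
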